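/- arXiv:1804.02306 — 2 statements merged into one kernel-verified Lean document; each statement's English description precedes it below -/
import Mathlib

section
/- Let S be a strongly admissible additive subsemigroup of ℤ^n × ℤ with Δ(S) ⊆ ℝ^n_{≥0}. Then Δ(S)^ess = ⋃_{k≥1} Conv(S^{k!})^ess, the sets Conv(S^{k!})^ess are nondecreasing in k, and Δ(S)^ess is a convex subset of ℝ^n_{≥0} that is open in the subspace topology of ℝ^n_{≥0}. -/
open Set

noncomputable section

/-- The embedding of the lattice `ℤ^n × ℤ` into `ℝ^n × ℝ`. -/
def latticeEmbed {n : ℕ} (x : (Fin n → ℤ) × ℤ) : (Fin n → ℝ) × ℝ :=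
  (fun i => (x.1 i : ℝ), (x.2 : ℝ))

/-- The set of all finite nonnegative linear combinations of elements of `T`. -/
def coneCombos {E : Type*} [AddCommMonoid E] [Module ℝ E] (T : Set E) : Set E :=
  {x | ∃ (k : ℕ) (c : Fin k → ℝ) (t : Fin k → E),
    (∀ i, 0 ≤ c i) ∧ (∀ i, t i ∈ T) ∧ x = ∑ i, c i • t i}

/-- `C(T)`: the closed convex cone generated by `T`. -/
def closedConeHull {E : Type*} [AddCommMonoid E] [Module ℝ E] [TopologicalSpace E]
    (T : Set E) : Set E :=
  closure (coneCombos T)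

/-- The closed convex cone `C(S) ⊆ ℝ^{n+1}` generated by a subset `S ⊆ ℤ^n × ℤ`. -/
def coneOf {n : ℕ} (S : Set ((Fin n → ℤ) × ℤ)) : Set ((Fin n → ℝ) × ℝ) :=
  closedConeHull (latticeEmbed '' S)

/-- The Okounkov convex set `Δ(S) = π(C(S) ∩ (ℝ^n × {1}))`. -/
def okounkovSet {n : ℕ} (S : Set ((Fin n → ℤ) × ℤ)) : Set (Fin n → ℝ) :=
  Prod.fst '' (coneOf S ∩ {x | x.2 = 1})

/-- `S^k = {α ∈ ℝ^n : kα ∈ ℤ^n and (kα, k) ∈ S}`. -/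
def Spow {n : ℕ} (S : Set ((Fin n → ℤ) × ℤ)) (k : ℕ) : Set (Fin n → ℝ) :=
  {α | ∃ β : Fin n → ℤ, (∀ i, (β i : ℝ) = (k : ℝ) * α i) ∧ (β, (k : ℤ)) ∈ S}


/-- `Conv(S^k)`: the closed convex hull of `S^k` in `ℝ^n`. -/
def convSpow {n : ℕ} (S : Set ((Fin n → ℤ) × ℤ)) (k : ℕ) : Set (Fin n → ℝ) :=
  closure (convexHull ℝ (Spow S k))

/-- The nonnegative orthant `ℝ^n_{≥0}`. -/
def nonnegOrthant (n : ℕ) : Set (Fin n → ℝ) := {x | ∀ i, 0 ≤ x i}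

/-- The essential part `A^ess` of a set `A ⊆ ℝ^n_{≥0}`: the interior of `A` in the
subspace topology of `ℝ^n_{≥0}`, viewed as a subset of `ℝ^n`. -/
def essSet {n : ℕ} (A : Set (Fin n → ℝ)) : Set (Fin n → ℝ) :=
  {x | x ∈ A ∧ ∃ U : Set (Fin n → ℝ), IsOpen U ∧ x ∈ U ∧ U ∩ nonnegOrthant n ⊆ A}

/-- The essential Okounkov body `Δ(S)^ess = ⋃_{k ≥ 1} Conv(S^k)^ess`. -/
def essOkounkov {n : ℕ} (S : Set ((Fin n → ℤ) × ℤ)) : Set (Fin n → ℝ) :=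
  ⋃ k : ℕ, ⋃ (_ : 1 ≤ k), essSet (convSpow S k)

theorem aux_nsmul {n : ℕ} {S : Set ((Fin n → ℤ) × ℤ)}
    (hsemi : ∀ a ∈ S, ∀ b ∈ S, a + b ∈ S) {a : (Fin n → ℤ) × ℤ} (ha : a ∈ S) (m : ℕ) :
    (m + 1) • a ∈ S := by
  induction m with
  | zero => simpa using ha
  | succ m ih => rw [succ_nsmul]; exact hsemi _ ih _ ha

theorem aux_Spow_mono {n : ℕ} {S : Set ((Fin n → ℤ) × ℤ)}
    (hsemi : ∀ a ∈ S, ∀ b ∈ S, a + b ∈ S) {k l : ℕ} (hl : l ≠ 0) (hkl : k ∣ l) :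
    Spow S k ⊆ Spow S l := by
  obtain ⟨m, rfl⟩ := hkl
  rintro α ⟨β, hβ, hS⟩
  obtain ⟨m, rfl⟩ : ∃ p, m = p + 1 := Nat.exists_eq_succ_of_ne_zero (by rintro rfl; simp at hl)
  refine ⟨(m + 1) • β, fun i => ?_, ?_⟩
  · simp only [Pi.smul_apply, nsmul_eq_mul]
    push_cast
    rw [hβ i]; ring
  · have := aux_nsmul hsemi hS m
    convert this using 1
    ext
    · simp
    · simp [mul_comm]

theorem aux_conv_mono {n : ℕ} {S : Set ((Fin n → ℤ) × ℤ)}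
    (hsemi : ∀ a ∈ S, ∀ b ∈ S, a + b ∈ S) {k l : ℕ} (hl : l ≠ 0) (hkl : k ∣ l) :
    convSpow S k ⊆ convSpow S l :=
  closure_mono (convexHull_mono (aux_Spow_mono hsemi hl hkl))

theorem aux_ess_mono {n : ℕ} {A B : Set (Fin n → ℝ)} (h : A ⊆ B) : essSet A ⊆ essSet B := by
  rintro x ⟨hx, U, hU, hxU, hUA⟩
  exact ⟨h hx, U, hU, hxU, hUA.trans h⟩

theorem aux_Spow_sub {n : ℕ} {S : Set ((Fin n → ℤ) × ℤ)} {k : ℕ} (hk : 1 ≤ k) :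
    Spow S k ⊆ okounkovSet S := by
  rintro α ⟨β, hβ, hS⟩
  have hk0 : (k : ℝ) ≠ 0 := by positivity
  refine ⟨(α, 1), ⟨subset_closure ⟨1, fun _ => (k : ℝ)⁻¹, fun _ => latticeEmbed (β, (k : ℤ)),
    fun _ => by positivity, fun _ => ⟨_, hS, rfl⟩, ?_⟩, rfl⟩, rfl⟩
  ext
  · simp [latticeEmbed, hβ, hk0]
  · simp [latticeEmbed, hk0]

theorem aux_conv_orth {n : ℕ} {S : Set ((Fin n → ℤ) × ℤ)}
    (horth : okounkovSet S ⊆ nonnegOrthant n) {k : ℕ} (hk : 1 ≤ k) :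
    convSpow S k ⊆ nonnegOrthant n := by
  have he : nonnegOrthant n = Set.Ici 0 := by ext x; simp [nonnegOrthant, Pi.le_def]
  have h : Spow S k ⊆ nonnegOrthant n := (aux_Spow_sub hk).trans horth
  rw [he] at h ⊢
  exact closure_minimal (convexHull_min h (convex_Ici 0)) isClosed_Ici

theorem aux_ess_convex {n : ℕ} {A : Set (Fin n → ℝ)} (hA : Convex ℝ A)
    (hP : A ⊆ nonnegOrthant n) : Convex ℝ (essSet A) := by
  rw [convex_iff_forall_pos]
  rintro x ⟨hx, U, hU, hxU, hUA⟩ y ⟨hy, V, hV, hyV, hVA⟩ a b ha hb hab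
  have hz : a • x + b • y ∈ A := hA hx hy ha.le hb.le hab
  refine ⟨hz, ?_⟩
  obtain ⟨z, hzdef⟩ : ∃ z, z = a • x + b • y := ⟨_, rfl⟩
  rw [← hzdef] at hz ⊢
  have hzi : ∀ i, z i = a * x i + b * y i := fun i => by rw [hzdef]; simp
  have hx0 : ∀ i, z i = 0 → x i = 0 := fun i h => by
    have h1 := mul_nonneg hb.le (hP hy i)
    have h2 := mul_nonneg ha.le (hP hx i)
    have h3 := hzi i
    have : a * x i = 0 := by linarith
    exact (mul_eq_zero.1 this).resolve_left ha.ne'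
  have hy0 : ∀ i, z i = 0 → y i = 0 := fun i h => by
    have h1 := mul_nonneg hb.le (hP hy i)
    have h2 := mul_nonneg ha.le (hP hx i)
    have h3 := hzi i
    have : b * y i = 0 := by linarith
    exact (mul_eq_zero.1 this).resolve_left hb.ne'
  let F : (Fin n → ℝ) → (Fin n → ℝ) → (Fin n → ℝ) :=
    fun u w i => (if z i = 0 then 1 else u i / z i) * w i
  have hF : ∀ u, Continuous (F u) := fun u => by fun_prop
  have hFz : ∀ u, (∀ i, z i = 0 → u i = 0) → F u z = u := fun u hu => by
    ext i
    by_cases h : z i = 0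
    · simp [F, h, hu i h]
    · simp [F, h]
  have hFP : ∀ u ∈ A, ∀ w ∈ nonnegOrthant n, F u w ∈ nonnegOrthant n := fun u hu w hw i => by
    apply mul_nonneg _ (hw i)
    split_ifs
    · exact zero_le_one
    · exact div_nonneg (hP hu i) (hP hz i)
  refine ⟨F x ⁻¹' U ∩ F y ⁻¹' V, (hU.preimage (hF x)).inter (hV.preimage (hF y)), ⟨?_, ?_⟩, ?_⟩
  · simpa [hFz x hx0] using hxU
  · simpa [hFz y hy0] using hyV
  · rintro w ⟨⟨hw1, hw2⟩, hw⟩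
    have h1 := hUA ⟨hw1, hFP x hx w hw⟩
    have h2 := hVA ⟨hw2, hFP y hy w hw⟩
    have h3 := hA h1 h2 ha.le hb.le hab
    convert h3 using 1
    ext i
    by_cases h : z i = 0
    · simp [F, h, ← add_mul, hab]
    · simp only [F, h, if_false, Pi.add_apply, Pi.smul_apply, smul_eq_mul]
      field_simp
      rw [hzi i]

/-- For a strongly admissible additive subsemigroup `S ⊆ ℤ^n × ℤ` with
`Δ(S) ⊆ ℝ^n_{≥0}`: `Δ(S)^ess = ⋃_{k ≥ 1} Conv(S^{k!})^ess`, the sets `Conv(S^{k!})^ess`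
are nondecreasing in `k`, and `Δ(S)^ess` is a convex subset of `ℝ^n_{≥0}` which is open
in the subspace topology of `ℝ^n_{≥0}`. -/
theorem essOkounkov_eq_iUnion_and_convex_and_open (n : ℕ) (hn : 1 ≤ n)
    (S : Set ((Fin n → ℤ) × ℤ))
    (hsemi : ∀ a ∈ S, ∀ b ∈ S, a + b ∈ S)
    (hadm : ∀ a ∈ S, 0 ≤ a.2)
    (hstrong : coneOf S ∩ {x | x.2 = 0} = {0})
    (horth : okounkovSet S ⊆ nonnegOrthant n) :
    (essOkounkov S = ⋃ k : ℕ, ⋃ (_ : 1 ≤ k), essSet (convSpow S (Nat.factorial k))) ∧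
    (∀ k l : ℕ, 1 ≤ k → k ≤ l →
      essSet (convSpow S (Nat.factorial k)) ⊆ essSet (convSpow S (Nat.factorial l))) ∧
    Convex ℝ (essOkounkov S) ∧
    essOkounkov S ⊆ nonnegOrthant n ∧
    (∀ x ∈ essOkounkov S, ∃ U : Set (Fin n → ℝ),
      IsOpen U ∧ x ∈ U ∧ U ∩ nonnegOrthant n ⊆ essOkounkov S) := by
  have hcx : ∀ k, Convex ℝ (convSpow S k) := fun k => (convex_convexHull ℝ _).closure
  refine ⟨?_, ?_, ?_, ?_, ?_⟩
  · apply Subset.antisymm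
    · refine iUnion₂_subset fun k hk => ?_
      exact (aux_ess_mono (aux_conv_mono hsemi (Nat.factorial_ne_zero k)
        (Nat.dvd_factorial hk le_rfl))).trans (subset_iUnion₂_of_subset k hk Subset.rfl)
    · refine iUnion₂_subset fun k hk => ?_
      exact subset_iUnion₂_of_subset (Nat.factorial k) (Nat.factorial_pos k) Subset.rfl
  · intro k l _ hkl
    exact aux_ess_mono (aux_conv_mono hsemi (Nat.factorial_ne_zero l)
      (Nat.factorial_dvd_factorial hkl))
  · intro x hx y hy a b ha hb hab
    simp only [essOkounkov, mem_iUnion] at hx hy ⊢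
    obtain ⟨k, hk, hx⟩ := hx
    obtain ⟨l, hl, hy⟩ := hy
    have hkl : k * l ≠ 0 := Nat.mul_ne_zero (by lia) (by lia)
    have h1 : 1 ≤ k * l := Nat.one_le_iff_ne_zero.2 hkl
    exact ⟨k * l, h1, aux_ess_convex (hcx _) (aux_conv_orth horth h1)
      (aux_ess_mono (aux_conv_mono hsemi hkl (Dvd.intro _ rfl)) hx)
      (aux_ess_mono (aux_conv_mono hsemi hkl (Dvd.intro_left _ rfl)) hy) ha hb hab⟩
  · refine iUnion₂_subset fun k hk => ?_
    exact fun x hx => aux_conv_orth horth hk hx.1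
  · intro x hx
    simp only [essOkounkov, mem_iUnion] at hx
    obtain ⟨k, hk, hx, U, hU, hxU, hUA⟩ := hx
    refine ⟨U, hU, hxU, fun w hw => ?_⟩
    simp only [essOkounkov, mem_iUnion]
    exact ⟨k, hk, hUA hw, U, hU, hw.1, hUA⟩
end
end

section
/- Let n, r ≥ 1 and let Γ be an additive subsemigroup of ℤ^n × ℤ^r_{≥0} that generates a subgroup of finite index in ℤ^{n+r}. Let π : ℝ^{n+r} → ℝ^r be the projection onto the last r coordinates and let Supp(Γ) := C(π(Γ)) ⊆ ℝ^r be the closed convex cone generated by π(Γ). Let a ∈ ℤ^r_{≥0} be a vector lying in the interior of Supp(Γ), and set Γ_{ℕa} := Γ ∩ (ℤ^n × ℕa), where ℕa := {m·a : m ∈ ℕ}. Then C(Γ_{ℕa}) = C(Γ) ∩ (ℝ^n × ℝa), where ℝa is the real line spanned by a. -/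
open Set

noncomputable section

/-- The embedding of the lattice `ℤ^n × ℤ^r` into `ℝ^n × ℝ^r`. -/
def latticeEmbed2 {n r : ℕ} (x : (Fin n → ℤ) × (Fin r → ℤ)) :
    (Fin n → ℝ) × (Fin r → ℝ) :=
  (fun i => (x.1 i : ℝ), fun i => (x.2 i : ℝ))

lemma cc_mem {E : Type*} [AddCommMonoid E] [Module ℝ E] {T : Set E} {x : E} (hx : x ∈ T) :
    x ∈ coneCombos T :=
  ⟨1, fun _ => 1, fun _ => x, by simp, by simp [hx], by simp⟩

lemma cc_zero {E : Type*} [AddCommMonoid E] [Module ℝ E] {T : Set E} :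
    (0 : E) ∈ coneCombos T :=
  ⟨0, fun _ => 1, fun _ => 0, by simp, fun i => i.elim0, by simp⟩

lemma cc_add {E : Type*} [AddCommMonoid E] [Module ℝ E] {T : Set E} {x y : E}
    (hx : x ∈ coneCombos T) (hy : y ∈ coneCombos T) : x + y ∈ coneCombos T := by
  obtain ⟨k, c, t, hc, ht, rfl⟩ := hx
  obtain ⟨l, d, s, hd, hs, rfl⟩ := hy
  refine ⟨k + l, Fin.append c d, Fin.append t s, ?_, ?_, ?_⟩
  · intro i
    induction i using Fin.addCases <;> simp [hc, hd]
  · intro i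
    induction i using Fin.addCases <;> simp [ht, hs]
  · simp [Fin.sum_univ_add]

lemma cc_smul {E : Type*} [AddCommMonoid E] [Module ℝ E] {T : Set E} {x : E} {b : ℝ}
    (hb : 0 ≤ b) (hx : x ∈ coneCombos T) : b • x ∈ coneCombos T := by
  obtain ⟨k, c, t, hc, ht, rfl⟩ := hx
  exact ⟨k, fun i => b * c i, t, fun i => mul_nonneg hb (hc i), ht, by
    simp [Finset.smul_sum, mul_smul]⟩

lemma cc_subset {E : Type*} [AddCommMonoid E] [Module ℝ E] {T : Set E} {P : Set E}
    (h0 : (0 : E) ∈ P) (hadd : ∀ x ∈ P, ∀ y ∈ P, x + y ∈ P)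
    (hsm : ∀ c : ℝ, 0 ≤ c → ∀ x ∈ P, c • x ∈ P) (hT : T ⊆ P) : coneCombos T ⊆ P := by
  rintro x ⟨k, c, t, hc, ht, rfl⟩
  exact Finset.sum_induction _ (· ∈ P) (fun x y hx hy => hadd x hx y hy) h0
    (fun i _ => hsm _ (hc i) _ (hT (ht i)))

lemma key_comb {R V ι : Type*} [CommRing R] [LinearOrder R] [IsStrictOrderedRing R]
    [AddCommGroup V] [Module R V] [Fintype ι] (P : Set V)
    (h0 : (0 : V) ∈ P) (hadd : ∀ x ∈ P, ∀ y ∈ P, x + y ∈ P)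
    (hsm : ∀ c : R, 0 ≤ c → ∀ x ∈ P, c • x ∈ P) (g : V) (hg : g ∈ P) (N : R) (b : ι → V)
    (hp : ∀ j, g + N • b j ∈ P) (hm : ∀ j, g - N • b j ∈ P)
    (z : ι → R) (k : R) (hk : ∑ j, |z j| ≤ k) : k • g + N • ∑ j, z j • b j ∈ P := by
  have e : k • g + N • ∑ j, z j • b j =
      (k - ∑ j, |z j|) • g + ∑ j, (|z j| • g + (N * z j) • b j) := by
    rw [Finset.sum_add_distrib, ← Finset.sum_smul, sub_smul, Finset.smul_sum]
    simp only [mul_smul]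
    abel
  rw [e]
  refine hadd _ (hsm _ (by linarith) _ hg) _ ?_
  refine Finset.sum_induction _ (· ∈ P) (fun x y hx hy => hadd x hx y hy) h0 (fun j _ => ?_)
  rcases le_total 0 (z j) with h | h
  · have := hsm _ h _ (hp j)
    rw [abs_of_nonneg h]
    rwa [smul_add, smul_smul, mul_comm] at this
  · have := hsm (- z j) (by linarith) _ (hm j)
    rw [abs_of_nonpos h]
    rw [smul_sub, smul_smul] at this
    convert this using 1
    rw [sub_eq_add_neg, ← neg_smul]
    congr 2
    ring

lemma exists_g {A ι : Type*} [AddCommGroup A] [Fintype ι] (Γ : Set A)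
    (hfin : (AddSubgroup.closure Γ).FiniteIndex) (b : ι → A) :
    ∃ g ∈ AddSubmonoid.closure Γ, ∃ N : ℕ, 0 < N ∧
      (∀ j, g + N • b j ∈ AddSubmonoid.closure Γ) ∧
      (∀ j, g - N • b j ∈ AddSubmonoid.closure Γ) := by
  classical
  set M := AddSubmonoid.closure Γ with hM
  have hdiff : ∀ x ∈ AddSubgroup.closure Γ, ∃ p ∈ M, ∃ q ∈ M, x = p - q := by
    intro x hx
    induction hx using AddSubgroup.closure_induction with
    | mem x hx => exact ⟨x, AddSubmonoid.subset_closure hx, 0, M.zero_mem, by simp⟩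
    | zero => exact ⟨0, M.zero_mem, 0, M.zero_mem, by simp⟩
    | add x y _ _ hx hy =>
      obtain ⟨p, hp, q, hq, rfl⟩ := hx
      obtain ⟨p', hp', q', hq', rfl⟩ := hy
      exact ⟨p + p', M.add_mem hp hp', q + q', M.add_mem hq hq', by abel⟩
    | neg x _ hx =>
      obtain ⟨p, hp, q, hq, rfl⟩ := hx
      exact ⟨q, hq, p, hp, by abel⟩
  set N := (AddSubgroup.closure Γ).index with hN
  have hmem : ∀ j, N • b j ∈ AddSubgroup.closure Γ := fun j =>
    AddSubgroup.nsmul_index_mem _ _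
  choose p hp q hq hpq using fun j => hdiff _ (hmem j)
  refine ⟨∑ j, (p j + q j), M.sum_mem fun j _ => M.add_mem (hp j) (hq j), N,
    Nat.pos_of_ne_zero hfin.index_ne_zero, fun j => ?_, fun j => ?_⟩
  · rw [← Finset.add_sum_erase _ _ (Finset.mem_univ j), hpq]
    have := M.add_mem (M.add_mem (hp j) (hp j))
      (M.sum_mem (t := Finset.univ.erase j) fun i _ => M.add_mem (hp i) (hq i))
    convert this using 1
    abel
  · rw [← Finset.add_sum_erase _ _ (Finset.mem_univ j), hpq]
    have := M.add_mem (M.add_mem (hq j) (hq j))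
      (M.sum_mem (t := Finset.univ.erase j) fun i _ => M.add_mem (hp i) (hq i))
    convert this using 1
    abel

/-- standard basis over any ring -/
def stdB (R : Type*) [Ring R] (n r : ℕ) : Fin n ⊕ Fin r → (Fin n → R) × (Fin r → R) :=
  Sum.elim (fun i => (Pi.single i 1, 0)) (fun i => (0, Pi.single i 1))

lemma stdB_sum (R : Type*) [Ring R] {n r : ℕ} (u : (Fin n → R) × (Fin r → R)) :
    ∑ j, (Sum.elim u.1 u.2 j) • stdB R n r j = u := by
  rw [Fintype.sum_sum_type]
  ext i
  · simp [stdB, Prod.fst_sum, Finset.sum_apply, Pi.single_apply]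
  · simp [stdB, Prod.snd_sum, Finset.sum_apply, Pi.single_apply]

lemma coord_le {n r : ℕ} (u : (Fin n → ℝ) × (Fin r → ℝ)) :
    ∑ j, |Sum.elim u.1 u.2 j| ≤ (n + r : ℝ) * ‖u‖ := by
  have : ∀ j ∈ Finset.univ, |Sum.elim u.1 u.2 j| ≤ ‖u‖ := by
    rintro (j | j) -
    · exact (norm_le_pi_norm u.1 j).trans (norm_fst_le u)
    · exact (norm_le_pi_norm u.2 j).trans (norm_snd_le u)
  refine (Finset.sum_le_sum this).trans ?_
  simp

/-- the embedding as an additive hom -/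
def emb (n r : ℕ) : ((Fin n → ℤ) × (Fin r → ℤ)) →+ ((Fin n → ℝ) × (Fin r → ℝ)) where
  toFun := latticeEmbed2
  map_zero' := by ext <;> simp [latticeEmbed2]
  map_add' x y := by ext <;> simp [latticeEmbed2]

lemma emb_apply {n r : ℕ} (x) : latticeEmbed2 x = emb n r x := rfl

lemma emb_stdB (n r : ℕ) (j) : emb n r (stdB ℤ n r j) = stdB ℝ n r j := by
  rcases j with j | j <;> ext i <;> simp [emb, stdB, latticeEmbed2, Pi.single_apply]

lemma mem_closure_semi {A : Type*} [AddCommGroup A] {Γ : Set A}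
    (hsemi : ∀ a ∈ Γ, ∀ b ∈ Γ, a + b ∈ Γ) {x : A} (hx : x ∈ AddSubmonoid.closure Γ) :
    x = 0 ∨ x ∈ Γ := by
  induction hx using AddSubmonoid.closure_induction with
  | mem x hx => exact Or.inr hx
  | zero => exact Or.inl rfl
  | add x y _ _ hx hy =>
    rcases hx with rfl | hx
    · simpa using hy
    · rcases hy with rfl | hy
      · simpa using Or.inr hx
      · exact Or.inr (hsemi _ hx _ hy)

lemma emb_cone {n r : ℕ} {Γ : Set ((Fin n → ℤ) × (Fin r → ℤ))} {x}
    (hx : x ∈ AddSubmonoid.closure Γ) : emb n r x ∈ coneCombos (latticeEmbed2 '' Γ) := by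
  induction hx using AddSubmonoid.closure_induction with
  | mem x hx => exact cc_mem ⟨x, hx, rfl⟩
  | zero => rw [map_zero]; exact cc_zero
  | add x y _ _ hx hy => rw [map_add]; exact cc_add hx hy

lemma interior_pt {n r : ℕ} {Γ : Set ((Fin n → ℤ) × (Fin r → ℤ))} {g} {N : ℕ} (hN : 0 < N)
    (hg : g ∈ AddSubmonoid.closure Γ)
    (hp : ∀ j, g + N • stdB ℤ n r j ∈ AddSubmonoid.closure Γ)
    (hm : ∀ j, g - N • stdB ℤ n r j ∈ AddSubmonoid.closure Γ) :
    ∃ δ : ℝ, 0 < δ ∧ ∀ ε : ℝ, ∀ u, ‖u‖ ≤ δ * ε →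
      ε • emb n r g + u ∈ coneCombos (latticeEmbed2 '' Γ) := by
  have hN' : (0 : ℝ) < N := by exact_mod_cast hN
  refine ⟨N / (n + r + 1), by positivity, fun ε u hu => ?_⟩
  have h1 : ∑ j, |Sum.elim ((N : ℝ)⁻¹ • u).1 ((N : ℝ)⁻¹ • u).2 j| ≤ ε := by
    refine (coord_le _).trans ?_
    rw [norm_smul, Real.norm_eq_abs, abs_of_pos (by positivity)]
    have hd : (0 : ℝ) < n + r + 1 := by positivity
    have h3 : (n + r + 1 : ℝ) * ‖u‖ ≤ N * ε := by
      calc (n + r + 1 : ℝ) * ‖u‖ ≤ (n + r + 1) * (N / (n + r + 1) * ε) := by gcongr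
        _ = N * ε := by field_simp
    have h4 : (n + r : ℝ) * ‖u‖ ≤ N * ε := by nlinarith [norm_nonneg u]
    calc (n + r : ℝ) * ((N : ℝ)⁻¹ * ‖u‖) = (N : ℝ)⁻¹ * ((n + r : ℝ) * ‖u‖) := by ring
      _ ≤ (N : ℝ)⁻¹ * (N * ε) := by gcongr
      _ = ε := by field_simp
  have := key_comb (R := ℝ) (coneCombos (latticeEmbed2 '' Γ)) cc_zero
    (fun x hx y hy => cc_add hx hy) (fun c hc x hx => cc_smul hc hx) (emb n r g)
    (emb_cone hg) N (stdB ℝ n r)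
    (fun j => by
      have := emb_cone (hp j)
      rwa [map_add, map_nsmul, emb_stdB, ← Nat.cast_smul_eq_nsmul ℝ] at this)
    (fun j => by
      have := emb_cone (hm j)
      rwa [map_sub, map_nsmul, emb_stdB, ← Nat.cast_smul_eq_nsmul ℝ] at this) _ ε h1
  rwa [stdB_sum, smul_inv_smul₀ hN'.ne'] at this

lemma approx {n r : ℕ} {Γ : Set ((Fin n → ℤ) × (Fin r → ℤ))} {g} {N : ℕ} (hN : 0 < N)
    (hsemi : ∀ a ∈ Γ, ∀ b ∈ Γ, a + b ∈ Γ)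
    (hg : g ∈ AddSubmonoid.closure Γ)
    (hp : ∀ j, g + N • stdB ℤ n r j ∈ AddSubmonoid.closure Γ)
    (hm : ∀ j, g - N • stdB ℤ n r j ∈ AddSubmonoid.closure Γ)
    (a : Fin r → ℤ) (z c : (Fin n → ℝ) × (Fin r → ℝ)) (ε s : ℝ) (hε : 0 < ε) (hs : 0 ≤ s)
    (hc : c ∈ coneCombos (latticeEmbed2 '' Γ)) (hz : z = ε • emb n r g + c)
    (hz2 : z.2 = s • fun i => (a i : ℝ)) :
    z ∈ closedConeHull (latticeEmbed2 '' (Γ ∩ {x | ∃ m : ℕ, x.2 = m • a})) := by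
  obtain ⟨k, c, t, hc, ht, rfl⟩ := hc
  choose τ hτ hτt using ht
  set M := AddSubmonoid.closure Γ with hM
  let v : ℕ → (Fin n → ℤ) × (Fin r → ℤ) := fun D =>
    (fun i => ⌊(D : ℝ) * z.1 i⌋, ⌊(D : ℝ) * s⌋ • a)
  set A : ℝ := 1 + ‖fun i => (a i : ℝ)‖ with hA
  set B : ℝ := A + ‖emb n r g‖ + ∑ i, ‖t i‖ with hB
  -- v D is close to D z
  have hv : ∀ D : ℕ, ‖emb n r (v D) - (D : ℝ) • z‖ ≤ A := by
    intro D
    have hA0 : 0 ≤ A := by positivity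
    rw [Prod.norm_def]
    refine max_le ?_ ?_
    · refine (pi_norm_le_iff_of_nonneg hA0).2 fun i => ?_
      have : |(⌊(D : ℝ) * z.1 i⌋ : ℝ) - D * z.1 i| ≤ 1 := by
        rw [abs_le]
        constructor <;> linarith [Int.floor_le ((D : ℝ) * z.1 i), Int.lt_floor_add_one ((D : ℝ) * z.1 i)]
      refine le_trans ?_ (this.trans (by rw [hA]; linarith [norm_nonneg (fun i => (a i : ℝ))]))
      simp [emb, latticeEmbed2, v]
    · have e : (emb n r (v D) - (D : ℝ) • z).2 =
          ((⌊(D : ℝ) * s⌋ : ℝ) - D * s) • (fun i => (a i : ℝ)) := by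
        ext i
        simp [emb, latticeEmbed2, v, hz2]
        ring
      rw [e, norm_smul]
      have : ‖(⌊(D : ℝ) * s⌋ : ℝ) - D * s‖ ≤ 1 := by
        rw [Real.norm_eq_abs, abs_le]
        constructor <;> linarith [Int.floor_le ((D : ℝ) * s), Int.lt_floor_add_one ((D : ℝ) * s)]
      nlinarith [norm_nonneg (fun i => (a i : ℝ))]
  have hfr : ∀ y : ℝ, ‖y - ⌊y⌋‖ ≤ 1 := fun y => by
    rw [Real.norm_eq_abs, abs_le]
    constructor <;> linarith [Int.floor_le y, Int.lt_floor_add_one y]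
  have hmem : ∀ D : ℕ, (n + r) * B ≤ ⌊(D : ℝ) * ε⌋ → N • v D ∈ M := by
    intro D hD
    set w := v D - ⌊(D : ℝ) * ε⌋ • g - ∑ i, ⌊(D : ℝ) * c i⌋ • τ i with hw
    have hwn : ‖emb n r w‖ ≤ B := by
      have e : emb n r w = (emb n r (v D) - (D : ℝ) • z) +
          ((D : ℝ) * ε - ⌊(D : ℝ) * ε⌋) • emb n r g +
          ∑ i, ((D : ℝ) * c i - ⌊(D : ℝ) * c i⌋) • t i := by
        rw [hw, map_sub, map_sub, map_sum, map_zsmul, hz]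
        simp only [map_zsmul, sub_smul, Finset.sum_sub_distrib, smul_add, Finset.smul_sum,
          mul_smul, Int.cast_smul_eq_zsmul, ← hτt, emb_apply]
        abel
      rw [e]
      refine (norm_add₃_le).trans ?_
      refine add_le_add (add_le_add (hv D) ?_) ((norm_sum_le _ _).trans
        (Finset.sum_le_sum fun i _ => ?_))
      · rw [norm_smul]
        nlinarith [hfr ((D : ℝ) * ε), norm_nonneg (emb n r g)]
      · rw [norm_smul]
        nlinarith [hfr ((D : ℝ) * c i), norm_nonneg (t i)]
    have hw1 : ∑ j, |Sum.elim w.1 w.2 j| ≤ ⌊(D : ℝ) * ε⌋ := by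
      have h1 := coord_le (emb n r w)
      have h2 : (n + r : ℝ) * ‖emb n r w‖ ≤ (n + r) * B := by gcongr
      have h3 : ((∑ j, |Sum.elim w.1 w.2 j| : ℤ) : ℝ) =
          ∑ j, |Sum.elim (emb n r w).1 (emb n r w).2 j| := by
        push_cast
        refine Finset.sum_congr rfl fun j _ => ?_
        rcases j with j | j <;> simp [emb, latticeEmbed2]
      have : ((∑ j, |Sum.elim w.1 w.2 j| : ℤ) : ℝ) ≤ (⌊(D : ℝ) * ε⌋ : ℝ) := by
        rw [h3]; linarith
      exact_mod_cast this
    have hfl : 0 ≤ ⌊(D : ℝ) * ε⌋ := le_trans (Finset.sum_nonneg fun _ _ => abs_nonneg _) hw1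
    have hsm : ∀ c : ℤ, 0 ≤ c → ∀ x ∈ M, c • x ∈ M := by
      intro c hc x hx
      lift c to ℕ using hc
      rw [natCast_zsmul]
      exact M.nsmul_mem hx c
    have h5 := key_comb (R := ℤ) (M : Set _) M.zero_mem
      (fun x hx y hy => M.add_mem hx hy) hsm g hg (N : ℤ) (stdB ℤ n r)
      (fun j => by rw [natCast_zsmul]; exact hp j)
      (fun j => by rw [natCast_zsmul]; exact hm j) _ ((N : ℤ) * ⌊(D : ℝ) * ε⌋)
      (hw1.trans (by nlinarith [(by exact_mod_cast hN : (1 : ℤ) ≤ N)]))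
    rw [stdB_sum] at h5
    have h6 : ∑ i, ⌊(D : ℝ) * c i⌋ • τ i ∈ M := M.sum_mem fun i _ =>
      hsm _ (Int.floor_nonneg.2 (mul_nonneg (Nat.cast_nonneg _) (hc i))) _
        (AddSubmonoid.subset_closure (hτ i))
    have h7 := M.add_mem h5 (M.nsmul_mem h6 N)
    convert h7 using 1
    rw [hw, mul_smul, natCast_zsmul, natCast_zsmul]
    simp only [smul_sub]
    abel
  have hN' : (0 : ℝ) < N := by exact_mod_cast hN
  have hev : ∀ᶠ D : ℕ in Filter.atTop, ((D : ℝ)⁻¹) • emb n r (v D) ∈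
      coneCombos (latticeEmbed2 '' (Γ ∩ {x | ∃ m : ℕ, x.2 = m • a})) := by
    have ht : Filter.Tendsto (fun D : ℕ => (D : ℝ) * ε) Filter.atTop Filter.atTop :=
      Filter.Tendsto.atTop_mul_const hε tendsto_natCast_atTop_atTop
    filter_upwards [ht.eventually_ge_atTop ((n + r) * B + 1)] with D hD
    have hD' := hmem D (by linarith [Int.lt_floor_add_one ((D : ℝ) * ε)])
    have e : ((D : ℝ)⁻¹) • emb n r (v D) = ((D : ℝ)⁻¹ * (N : ℝ)⁻¹) • emb n r (N • v D) := by
      rw [map_nsmul, ← Nat.cast_smul_eq_nsmul ℝ, mul_smul, inv_smul_smul₀ hN'.ne']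
    rw [e]
    refine cc_smul (by positivity) ?_
    rcases mem_closure_semi hsemi hD' with h | h
    · rw [h, map_zero]; exact cc_zero
    · refine cc_mem ⟨_, ⟨h, N * ⌊(D : ℝ) * s⌋.toNat, ?_⟩, rfl⟩
      have h0 : 0 ≤ ⌊(D : ℝ) * s⌋ := Int.floor_nonneg.2 (by positivity)
      rw [mul_smul, ← natCast_zsmul a, Int.toNat_of_nonneg h0]
      rfl
  have hlim : Filter.Tendsto (fun D : ℕ => ((D : ℝ)⁻¹) • emb n r (v D)) Filter.atTop (nhds z) := by
    rw [tendsto_iff_norm_sub_tendsto_zero]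
    have h0 : Filter.Tendsto (fun D : ℕ => (D : ℝ)⁻¹ * A) Filter.atTop (nhds 0) := by
      simpa using (tendsto_inv_atTop_nhds_zero_nat (𝕜 := ℝ)).mul_const A
    refine squeeze_zero' (Filter.Eventually.of_forall fun _ => norm_nonneg _) ?_ h0
    filter_upwards [Filter.eventually_gt_atTop 0] with D hD
    have hD' : (0 : ℝ) < D := by exact_mod_cast hD
    have e : ((D : ℝ)⁻¹) • emb n r (v D) - z =
        (D : ℝ)⁻¹ • (emb n r (v D) - (D : ℝ) • z) := by
      rw [smul_sub, inv_smul_smul₀ hD'.ne']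
    rw [e, norm_smul, Real.norm_eq_abs, abs_of_pos (by positivity)]
    gcongr
    exact hv D
  exact mem_closure_of_tendsto hlim hev

/-- Let `Γ ⊆ ℤ^n × ℤ^r_{≥0}` be an additive subsemigroup generating a
subgroup of finite index in `ℤ^{n+r}`, and let `a ∈ ℤ^r_{≥0}` lie in the interior of the
support `Supp(Γ) = C(π(Γ)) ⊆ ℝ^r` (where `π` projects onto the last `r` coordinates).
If `Γ_{ℕa} = Γ ∩ (ℤ^n × ℕa)`, then `C(Γ_{ℕa}) = C(Γ) ∩ (ℝ^n × ℝa)`. -/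
theorem closedConeHull_inter_line (n r : ℕ) (hn : 1 ≤ n) (hr : 1 ≤ r)
    (Γ : Set ((Fin n → ℤ) × (Fin r → ℤ)))
    (hsemi : ∀ a ∈ Γ, ∀ b ∈ Γ, a + b ∈ Γ)
    (hadm : ∀ x ∈ Γ, ∀ i, 0 ≤ x.2 i)
    (hfin : (AddSubgroup.closure Γ).FiniteIndex)
    (a : Fin r → ℤ) (ha : ∀ i, 0 ≤ a i)
    (haint : (fun i => (a i : ℝ)) ∈ interior (closedConeHull
      ((fun x : (Fin n → ℤ) × (Fin r → ℤ) => fun i => (x.2 i : ℝ)) '' Γ))) :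
    closedConeHull (latticeEmbed2 '' (Γ ∩ {x | ∃ m : ℕ, x.2 = m • a})) =
      closedConeHull (latticeEmbed2 '' Γ) ∩
        {x | ∃ t : ℝ, x.2 = t • fun i => (a i : ℝ)} := by
  apply Set.Subset.antisymm
  · -- easy inclusion
    refine Set.subset_inter (closure_mono ?_) ?_
    · exact cc_subset cc_zero (fun x hx y hy => cc_add hx hy) (fun c hc x hx => cc_smul hc hx)
        (fun x hx => cc_mem (Set.image_mono Set.inter_subset_left hx))
    · let S : Submodule ℝ ((Fin n → ℝ) × (Fin r → ℝ)) :=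
        (Submodule.span ℝ {fun i => (a i : ℝ)}).comap (LinearMap.snd ℝ _ _)
      have hS : {x : (Fin n → ℝ) × (Fin r → ℝ) | ∃ t : ℝ, x.2 = t • fun i => (a i : ℝ)} = S := by
        ext x
        simp only [S, Set.mem_ofPred_eq, Submodule.comap_coe, Set.mem_preimage, SetLike.mem_coe,
          Submodule.mem_span_singleton, LinearMap.snd_apply]
        exact ⟨fun ⟨t, h⟩ => ⟨t, h.symm⟩, fun ⟨t, h⟩ => ⟨t, h.symm⟩⟩
      rw [hS]
      refine closure_minimal ?_ S.closed_of_finiteDimensional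
      refine cc_subset S.zero_mem (fun x hx y hy => S.add_mem hx hy)
        (fun c _ x hx => S.smul_mem c hx) ?_
      rw [← hS]
      rintro _ ⟨x, ⟨_, m, hm⟩, rfl⟩
      refine ⟨m, ?_⟩
      ext i
      simp [latticeEmbed2, hm]
  · obtain ⟨g, hg, N, hN, hp, hm⟩ := exists_g Γ hfin (stdB ℤ n r)
    obtain ⟨δ, hδ, hint⟩ := interior_pt hN hg hp hm
    set ar : Fin r → ℝ := fun i => (a i : ℝ) with har
    set C := coneCombos (latticeEmbed2 '' Γ) with hC
    have hCnn : C ⊆ {x : (Fin n → ℝ) × (Fin r → ℝ) | ∀ i, 0 ≤ x.2 i} := by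
      refine cc_subset (by simp) (fun x hx y hy i => add_nonneg (hx i) (hy i))
        (fun c hc x hx i => mul_nonneg hc (hx i)) ?_
      rintro _ ⟨x, hx, rfl⟩ i
      have := hadm x hx i
      simpa [latticeEmbed2] using this
    -- step 2
    obtain ⟨ε, hε, h, hh, hha⟩ : ∃ ε : ℝ, 0 < ε ∧ ∃ h ∈ C, (ε • emb n r g + h).2 = ar := by
      obtain ⟨η, hη, hball⟩ := Metric.isOpen_iff.1 isOpen_interior _ haint
      set G := (emb n r g).2 with hG
      set ε := η / (4 * (‖G‖ + 1)) with hεd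
      have hε : 0 < ε := by positivity
      have h1 : ar - (2 * ε) • G ∈ Metric.ball ar η := by
        rw [mem_ball_iff_norm]
        have e : ar - (2 * ε) • G - ar = -((2 * ε) • G) := by abel
        rw [e, norm_neg, norm_smul, Real.norm_eq_abs, abs_of_pos (by positivity)]
        have : ε * (4 * (‖G‖ + 1)) = η := by rw [hεd]; field_simp
        nlinarith [norm_nonneg G]
      have h2 := interior_subset (hball h1)
      obtain ⟨z, hz, hzd⟩ := Metric.mem_closure_iff.1 h2 (δ * ε) (by positivity)
      obtain ⟨h, hh, rfl⟩ : ∃ h ∈ C, h.2 = z := by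
        have := cc_subset (P := Prod.snd '' C)
          (T := (fun x : (Fin n → ℤ) × (Fin r → ℤ) => fun i => (x.2 i : ℝ)) '' Γ)
          ⟨0, cc_zero, rfl⟩
          (by rintro _ ⟨x, hx, rfl⟩ _ ⟨y, hy, rfl⟩; exact ⟨x + y, cc_add hx hy, rfl⟩)
          (by rintro c hc _ ⟨x, hx, rfl⟩; exact ⟨c • x, cc_smul hc hx, rfl⟩)
          (by rintro _ ⟨x, hx, rfl⟩; exact ⟨latticeEmbed2 x, cc_mem ⟨x, hx, rfl⟩, rfl⟩)
        exact this hz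
      have h3 := hint ε ((0 : Fin n → ℝ), ar - (2 * ε) • G - h.2) (by
        rw [dist_eq_norm] at hzd
        rw [Prod.norm_def]
        simp only [norm_zero]
        exact max_le (by positivity) hzd.le)
      refine ⟨ε, hε, _, cc_add hh h3, ?_⟩
      simp only [Prod.snd_add, Prod.smul_snd, ← hG, two_mul, add_smul]
      abel
    -- a has a positive coordinate
    let i0 : Fin r := ⟨0, hr⟩
    have hg0 : 0 < (emb n r g).2 i0 := by
      have h1 := hCnn (emb_cone (hm (Sum.inr i0))) i0
      have : (0 : ℝ) < N := by exact_mod_cast hN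
      simp [emb, latticeEmbed2, stdB] at h1 ⊢
      have h2 : (N : ℝ) ≤ (g.2 i0 : ℝ) := by exact_mod_cast h1
      exact_mod_cast this.trans_le h2
    have ha0 : 0 < ar i0 := by
      rw [← hha]
      have := hCnn hh i0
      simp only [Prod.snd_add, Prod.smul_snd, Pi.add_apply, Pi.smul_apply, smul_eq_mul]
      have := mul_pos hε hg0
      linarith
    rintro x ⟨hx, t, hxt⟩
    have ht : 0 ≤ t := by
      have hcl : IsClosed {x : (Fin n → ℝ) × (Fin r → ℝ) | 0 ≤ x.2 i0} :=
        isClosed_le continuous_const (by fun_prop)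
      have h1 : 0 ≤ x.2 i0 := closure_minimal (fun y hy => hCnn hy i0) hcl hx
      rw [hxt] at h1
      simp only [Pi.smul_apply, smul_eq_mul] at h1
      exact nonneg_of_mul_nonneg_left h1 ha0
    have hstep : ∀ s : ℝ, 0 < s → x + s • (ε • emb n r g + h) ∈
        closedConeHull (latticeEmbed2 '' (Γ ∩ {x | ∃ m : ℕ, x.2 = m • a})) := by
      intro s hs
      obtain ⟨x', hx', hxd⟩ := Metric.mem_closure_iff.1 hx (δ * (s * ε / 2)) (by positivity)
      rw [dist_eq_norm] at hxd
      refine approx hN hsemi hg hp hm a _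
        (x' + s • h + ((s * ε / 2) • emb n r g + (x - x'))) (s * ε / 2) (t + s)
        (by positivity) (by positivity)
        (cc_add (cc_add hx' (cc_smul hs.le hh)) (hint _ _ hxd.le)) ?_ ?_
      · module
      · rw [Prod.snd_add, Prod.smul_snd, hha, hxt, add_smul]
    have hlim : Filter.Tendsto (fun s : ℝ => x + s • (ε • emb n r g + h))
        (nhdsWithin 0 (Set.Ioi 0)) (nhds x) := by
      have : Continuous (fun s : ℝ => x + s • (ε • emb n r g + h)) := by fun_prop
      have h2 := this.tendsto 0
      simp only [zero_smul, add_zero] at h2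
      exact h2.mono_left nhdsWithin_le_nhds
    exact isClosed_closure.mem_of_tendsto hlim
      (Filter.eventually_of_mem self_mem_nhdsWithin fun s hs => hstep s hs)
end
end
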